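/- arXiv:1303.3567 — 2 statements merged into one kernel-verified Lean document; each statement's English description precedes it below -/
import Mathlib

section
/- Let C be a symmetric monoidal closed category with internal hom [−,−], and let (X, Y, η, μ, ψ, ε, δ, φ) be a left Frobenius pair in C. Then there is an isomorphism [X, 𝟙] ≅ Y between the internal dual of X and Y. -/
open CategoryTheory MonoidalCategory

universe v u

/-- A left Frobenius pair in a monoidal category `C`, following Rezk:
objects `X`, `Y`; a monoid structure `(X, η, μ)`; a comonoid structure `(Y, ε, δ)`;
a left `X`-module structure `ψ` on `Y`; a left `Y`-comodule structure `φ` on `X`;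
such that `φ` is a map of left `X`-modules and `ψ` is a map of left `Y`-comodules. -/
structure LeftFrobeniusPair (C : Type u) [Category.{v} C] [MonoidalCategory C] where
  X : C
  Y : C
  η : 𝟙_ C ⟶ X
  μ : X ⊗ X ⟶ X
  ψ : X ⊗ Y ⟶ Y
  ε : Y ⟶ 𝟙_ C
  δ : Y ⟶ Y ⊗ Y
  φ : X ⟶ Y ⊗ X
  /-- (1a) associativity of `μ` -/
  mul_assoc' : (μ ▷ X) ≫ μ = (α_ X X X).hom ≫ (X ◁ μ) ≫ μ
  /-- (1a) left unit -/
  one_mul' : (η ▷ X) ≫ μ = (λ_ X).hom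
  /-- (1a) right unit -/
  mul_one' : (X ◁ η) ≫ μ = (ρ_ X).hom
  /-- (1b) coassociativity of `δ` -/
  comul_assoc' : δ ≫ (δ ▷ Y) ≫ (α_ Y Y Y).hom = δ ≫ (Y ◁ δ)
  /-- (1b) left counit -/
  counit_comul' : δ ≫ (ε ▷ Y) = (λ_ Y).inv
  /-- (1b) right counit -/
  comul_counit' : δ ≫ (Y ◁ ε) = (ρ_ Y).inv
  /-- (2a) `ψ` is an action -/
  mul_act' : (μ ▷ Y) ≫ ψ = (α_ X X Y).hom ≫ (X ◁ ψ) ≫ ψ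
  /-- (2a) unit acts trivially -/
  one_act' : (η ▷ Y) ≫ ψ = (λ_ Y).hom
  /-- (2b) `φ` is a coaction -/
  coact_comul' : φ ≫ (δ ▷ X) ≫ (α_ Y Y X).hom = φ ≫ (Y ◁ φ)
  /-- (2b) counit of the coaction -/
  coact_counit' : φ ≫ (ε ▷ X) = (λ_ X).inv
  /-- (3a) `φ` is a homomorphism of left `X`-modules -/
  phi_module' : μ ≫ φ = (X ◁ φ) ≫ (α_ X Y X).inv ≫ (ψ ▷ X)
  /-- (3b) `ψ` is a homomorphism of left `Y`-comodules -/
  psi_comodule' : ψ ≫ δ = (φ ▷ Y) ≫ (α_ Y X Y).hom ≫ (Y ◁ ψ)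

/-- In a left Frobenius pair, `Y` and `X` form an exact pairing: the counit is `ψ ≫ ε` and
the unit is `η ≫ φ`. -/
abbrev LeftFrobeniusPair.exactPairing {C : Type u} [Category.{v} C] [MonoidalCategory C]
    (P : LeftFrobeniusPair C) : ExactPairing P.Y P.X where
  coevaluation' := P.η ≫ P.φ
  evaluation' := P.ψ ≫ P.ε
  coevaluation_evaluation' := by
    calc
      _ = (P.X ◁ P.η) ≫ ((P.X ◁ P.φ) ≫ (α_ P.X P.Y P.X).inv ≫ (P.ψ ▷ P.X)) ≫
          (P.ε ▷ P.X) := by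
        simp only [MonoidalCategory.whiskerLeft_comp, comp_whiskerRight, Category.assoc]
      _ = (ρ_ P.X).hom ≫ (λ_ P.X).inv := by
        rw [← P.phi_module', Category.assoc, P.coact_counit', reassoc_of% P.mul_one']
  evaluation_coevaluation' := by
    calc
      _ = (P.η ▷ P.Y) ≫ ((P.φ ▷ P.Y) ≫ (α_ P.Y P.X P.Y).hom ≫ (P.Y ◁ P.ψ)) ≫
          (P.Y ◁ P.ε) := by
        simp only [MonoidalCategory.whiskerLeft_comp, comp_whiskerRight, Category.assoc]
      _ = (λ_ P.Y).hom ≫ (ρ_ P.Y).inv := by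
        rw [← P.psi_comodule', Category.assoc, P.comul_counit', reassoc_of% P.one_act']

/-- In a symmetric monoidal closed category, a left Frobenius pair gives an
isomorphism `[X, 𝟙] ≅ Y` between the internal dual of `X` and `Y`. -/
theorem stmt15 {C : Type u} [Category.{v} C] [MonoidalCategory C] [SymmetricCategory C]
    [MonoidalClosed C] (P : LeftFrobeniusPair C) :
    Nonempty ((ihom P.X).obj (𝟙_ C) ≅ P.Y) := by
  let _ := P.exactPairing
  exact ⟨((ihom.adjunction P.X).rightAdjointUniq (tensorLeftAdjunction P.Y P.X)).app (𝟙_ C) ≪≫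
    ρ_ P.Y⟩
end

section
/- Let (X, Y, η, μ, ψ, ε, δ, φ) be a left Frobenius pair in a monoidal category C, with α = φ ∘ η and β = ε ∘ ψ. Then β ∘ α-composite computes ε ∘ ψ ∘ (η ⊗ Y)-style compatibility: specifically, the composite 𝟙 →α Y ⊗ X →(braiding-free pairing) evaluated against the counits satisfies ε-compatibility: (ε ⊗ id) then μ-unit laws give λ(β where U = Y, V = 𝟙) recovering that λ⁻¹ applied to δ equals ψ, i.e., (β ⊗ Y) ∘ assoc⁻¹ ∘ (X ⊗ δ) composed with the left unitor equals ψ as morphisms X ⊗ Y → Y. -/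
open CategoryTheory MonoidalCategory

universe v u

namespace LeftFrobeniusPair

variable {C : Type u} [Category.{v} C] [MonoidalCategory C] (P : LeftFrobeniusPair C)

/-- The comultiplication is the mate of the action: `δ = (Y ⊗ ψ) ∘ (α ⊗ Y)`. -/
theorem comul_eq : P.δ = (λ_ P.Y).inv ≫ ((P.η ≫ P.φ) ▷ P.Y) ≫ (α_ P.Y P.X P.Y).hom ≫
    (P.Y ◁ P.ψ) := by
  rw [comp_whiskerRight, Category.assoc, ← P.psi_comodule', reassoc_of% P.one_act',
    Iso.inv_hom_id_assoc]

/-- The triangle identity `(β ⊗ X) ∘ (X ⊗ α) = id`. -/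
theorem triangle : (P.X ◁ (P.η ≫ P.φ)) ≫ (α_ P.X P.Y P.X).inv ≫ ((P.ψ ≫ P.ε) ▷ P.X) =
    (ρ_ P.X).hom ≫ (λ_ P.X).inv := by
  have h := P.phi_module' =≫ (P.ε ▷ P.X)
  simp only [Category.assoc, P.coact_counit'] at h
  rw [whiskerLeft_comp, comp_whiskerRight, Category.assoc, ← h, reassoc_of% P.mul_one']

end LeftFrobeniusPair

/-- `λ⁻¹` applied to `δ` equals `ψ`: with `β = ε ∘ ψ`, the composite
`(β ⊗ Y) ∘ assoc⁻¹ ∘ (X ⊗ δ)` followed by the left unitor equals `ψ`. -/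
theorem stmt16 {C : Type u} [Category.{v} C] [MonoidalCategory C]
    (P : LeftFrobeniusPair C) :
    (P.X ◁ P.δ) ≫ (α_ P.X P.Y P.Y).inv ≫ ((P.ψ ≫ P.ε) ▷ P.Y) ≫ (λ_ P.Y).hom = P.ψ := by
  calc
    _ = (P.X ◁ (λ_ P.Y).inv) ≫ (α_ P.X (𝟙_ C) P.Y).inv ≫
        (((P.X ◁ (P.η ≫ P.φ)) ≫ (α_ P.X P.Y P.X).inv ≫ ((P.ψ ≫ P.ε) ▷ P.X)) ▷ P.Y) ≫
        (α_ (𝟙_ C) P.X P.Y).hom ≫ (λ_ (P.X ⊗ P.Y)).hom ≫ P.ψ := by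
      have h : ((P.X ⊗ P.Y) ◁ P.ψ) ≫ ((P.ψ ≫ P.ε) ▷ P.Y) ≫ (λ_ P.Y).hom =
          ((P.ψ ≫ P.ε) ▷ (P.X ⊗ P.Y)) ≫ (λ_ (P.X ⊗ P.Y)).hom ≫ P.ψ := by
        rw [whisker_exchange_assoc, leftUnitor_naturality]
      rw [P.comul_eq]
      generalize P.η ≫ P.φ = a
      generalize P.ψ ≫ P.ε = b at h ⊢
      calc
        _ = (P.X ◁ (λ_ P.Y).inv) ≫ (P.X ◁ (a ▷ P.Y)) ≫ (P.X ◁ (α_ P.Y P.X P.Y).hom) ≫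
            (α_ P.X P.Y (P.X ⊗ P.Y)).inv ≫ ((P.X ⊗ P.Y) ◁ P.ψ) ≫ (b ▷ P.Y) ≫
            (λ_ P.Y).hom := by simp
        _ = _ := by
          rw [h]
          monoidal
    _ = P.ψ := by
      rw [P.triangle]
      monoidal
end
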